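/- Let p be an odd prime, q = p^m with q = 2^a·b + 1, b odd, a ≥ r ≥ 1, and N = 2^r·p^s. Let θ ∈ F_q be a primitive 2^r-th root of unity, let (i_0, …, i_{2^r−1}) be a permutation of (0, …, 2^r−1), and let p^s ≥ j_0 ≥ j_1 ≥ … ≥ j_{2^r−1} ≥ 0 be integers. Let C be the ideal of F_q[x]/(x^N − 1) generated by ∏_{h=0}^{2^r−1} (x − θ^{i_h})^{j_h}. Then C is MDS if and only if exactly one of the following holds: (1) j_0 = 0, in which case d_H(C) = 1; (2) j_0 = 1 and j_1 = 0, in which case d_H(C) = 2; (3) j_0 = j_1 = … = j_{2^r−2} = p^s and j_{2^r−1} = p^s − 1, in which case d_H(C) = 2^r·p^s. -/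

import Mathlib

open Polynomial
open scoped Classical

/-- The coefficient vector (with respect to the basis `1, x, …, x^{deg f − 1}` of
`F[x]/(f)`) of an element of `F[x]/(f)`. -/
noncomputable def coeffRepr {F : Type*} [Field F] {f : Polynomial F} (hf : f ≠ 0)
    (x : AdjoinRoot f) (i : Fin (AdjoinRoot.powerBasis hf).dim) : F :=
  (AdjoinRoot.powerBasis hf).basis.repr x i

/-- The Hamming weight of a codeword. -/
noncomputable def hammingWeight {F : Type*} [Field F] {f : Polynomial F} (hf : f ≠ 0)
    (x : AdjoinRoot f) : ℕ :=
  (Finset.univ.filter fun i => coeffRepr hf x i ≠ 0).card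

/-- The Hamming distance of a code `C ⊆ F[x]/(f)`. -/
noncomputable def dHamming {F : Type*} [Field F] {f : Polynomial F} (hf : f ≠ 0)
    (C : Ideal (AdjoinRoot f)) : ℕ :=
  sInf {w | ∃ x ∈ C, x ≠ 0 ∧ w = hammingWeight hf x}

/-- The last index `2^r − 1` of `Fin (2^r)`. -/
def lastIdx (r : ℕ) : Fin (2 ^ r) := ⟨2 ^ r - 1, Nat.sub_lt (Nat.two_pow_pos r) Nat.one_pos⟩

section QuotientCodes

variable {F : Type*} [Field F]

theorem hammingWeight_mk_of_natDegree_lt {f : F[X]} (hf : f ≠ 0) {Q : F[X]}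
    (hQ : Q.natDegree < f.natDegree) :
    hammingWeight hf (AdjoinRoot.mk f Q) = Q.support.card := by
  have hdim : (AdjoinRoot.powerBasis hf).dim = f.natDegree := AdjoinRoot.powerBasis_dim hf
  have hsum : AdjoinRoot.mk f Q = ∑ i : Fin (AdjoinRoot.powerBasis hf).dim,
      Q.coeff i • (AdjoinRoot.powerBasis hf).basis i := by
    simp only [PowerBasis.coe_basis, AdjoinRoot.powerBasis_gen]
    rw [Fin.sum_univ_eq_sum_range (fun i => Q.coeff i • AdjoinRoot.root f ^ i), hdim]
    conv_lhs => rw [Q.as_sum_range' _ hQ, map_sum]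
    refine Finset.sum_congr rfl fun i _ => ?_
    rw [← C_mul_X_pow_eq_monomial, map_mul, map_pow, AdjoinRoot.mk_C, AdjoinRoot.mk_X,
      Algebra.smul_def, AdjoinRoot.algebraMap_eq]
  have hcoeff : ∀ i, coeffRepr hf (AdjoinRoot.mk f Q) i = Q.coeff i := by
    intro i
    rw [coeffRepr, hsum, Module.Basis.repr_sum_self]
  unfold hammingWeight
  simp only [hcoeff]
  refine Finset.card_bij (fun i _ => (i : ℕ)) ?_ ?_ ?_
  · intro i hi
    simpa using hi
  · intro i _ i' _ h
    exact Fin.ext h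
  · intro k hk
    have hk' : k < (AdjoinRoot.powerBasis hf).dim := by
      rw [hdim]
      exact (le_natDegree_of_mem_supp k hk).trans_lt hQ
    exact ⟨⟨k, hk'⟩, by simpa using hk, rfl⟩

theorem exists_natDegree_lt_mk_eq {f : F[X]} (hf : 0 < f.natDegree) (x : AdjoinRoot f) :
    ∃ Q : F[X], Q.natDegree < f.natDegree ∧ AdjoinRoot.mk f Q = x := by
  obtain ⟨P, rfl⟩ := AdjoinRoot.mk_surjective x
  refine ⟨P % f, natDegree_mod_lt P hf.ne', ?_⟩
  rw [AdjoinRoot.mk_eq_mk]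
  exact ⟨-(P / f), by rw [EuclideanDomain.mod_eq_sub_mul_div]; ring⟩

theorem mk_mem_span_mk_iff {f g : F[X]} (hgf : g ∣ f) (P : F[X]) :
    AdjoinRoot.mk f P ∈ Ideal.span {AdjoinRoot.mk f g} ↔ g ∣ P := by
  rw [Ideal.mem_span_singleton]
  constructor
  · rintro ⟨y, hy⟩
    obtain ⟨R, rfl⟩ := AdjoinRoot.mk_surjective y
    rw [← map_mul, AdjoinRoot.mk_eq_mk] at hy
    exact (dvd_sub_left (dvd_mul_right g R)).mp (hgf.trans hy)
  · exact map_dvd _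

theorem finrank_span_mk_add_natDegree {f g : F[X]} (hf : f ≠ 0) (hgf : g ∣ f) :
    Module.finrank F (Submodule.restrictScalars F (Ideal.span {AdjoinRoot.mk f g})) +
      g.natDegree = f.natDegree := by
  have hg : g ≠ 0 := ne_zero_of_dvd_ne_zero hf hgf
  let φ : AdjoinRoot f →ₐ[F] AdjoinRoot g :=
    Ideal.Quotient.factorₐ F (Ideal.span_singleton_le_span_singleton.mpr hgf)
  have hφ : ∀ P, φ (AdjoinRoot.mk f P) = AdjoinRoot.mk g P := fun P => rfl
  have hsurj : Function.Surjective φ := by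
    intro y
    obtain ⟨P, rfl⟩ := AdjoinRoot.mk_surjective y
    exact ⟨_, hφ P⟩
  have hker : LinearMap.ker φ.toLinearMap =
      Submodule.restrictScalars F (Ideal.span {AdjoinRoot.mk f g}) := by
    ext x
    obtain ⟨P, rfl⟩ := AdjoinRoot.mk_surjective x
    rw [LinearMap.mem_ker, Submodule.restrictScalars_mem, mk_mem_span_mk_iff hgf,
      AlgHom.toLinearMap_apply, hφ, AdjoinRoot.mk_eq_zero]
  have : Module.Finite F (AdjoinRoot f) := (AdjoinRoot.powerBasis hf).finite
  have h := LinearMap.finrank_range_add_finrank_ker φ.toLinearMap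
  rw [LinearMap.range_eq_top.mpr hsurj, finrank_top, hker,
    (AdjoinRoot.powerBasis hf).finrank, (AdjoinRoot.powerBasis hg).finrank,
    AdjoinRoot.powerBasis_dim, AdjoinRoot.powerBasis_dim] at h
  omega

theorem hammingWeight_mk_le_card_support {N : ℕ} (hN : 0 < N) (hf : (X ^ N - 1 : F[X]) ≠ 0)
    (P : F[X]) : hammingWeight hf (AdjoinRoot.mk _ P) ≤ P.support.card := by
  have hdeg : (X ^ N - 1 : F[X]).natDegree = N := by
    simpa using natDegree_X_pow_sub_C (n := N) (r := (1 : F))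
  let Q : F[X] := ∑ i ∈ P.support, monomial (i % N) (P.coeff i)
  have hPQ : AdjoinRoot.mk (X ^ N - 1 : F[X]) P = AdjoinRoot.mk _ Q := by
    have hroot : (AdjoinRoot.root (X ^ N - 1 : F[X])) ^ N = 1 := by
      rw [← AdjoinRoot.mk_X, ← map_pow, ← map_one (AdjoinRoot.mk _), AdjoinRoot.mk_eq_mk]
    conv_lhs => rw [P.as_sum_support]
    simp only [Q, map_sum]
    refine Finset.sum_congr rfl fun i _ => ?_
    rw [← C_mul_X_pow_eq_monomial, ← C_mul_X_pow_eq_monomial, map_mul, map_mul, map_pow, map_pow,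
      AdjoinRoot.mk_X, ← pow_eq_pow_mod i hroot]
  have hQsupp : Q.support ⊆ P.support.image (· % N) := by
    intro k hk
    rw [mem_support_iff, finsetSum_coeff] at hk
    obtain ⟨i, hi, hik⟩ := Finset.exists_ne_zero_of_sum_ne_zero hk
    rw [coeff_monomial] at hik
    refine Finset.mem_image.mpr ⟨i, hi, ?_⟩
    by_contra h
    exact hik (if_neg h)
  have hQdeg : Q.natDegree < (X ^ N - 1 : F[X]).natDegree := by
    rw [hdeg, Nat.lt_iff_le_pred hN]
    refine natDegree_le_iff_coeff_eq_zero.mpr fun k hk => ?_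
    by_contra h
    obtain ⟨i, -, rfl⟩ := Finset.mem_image.mp (hQsupp (mem_support_iff.mpr h))
    have := Nat.mod_lt i hN
    omega
  rw [hPQ, hammingWeight_mk_of_natDegree_lt hf hQdeg]
  exact (Finset.card_le_card hQsupp).trans Finset.card_image_le

theorem dHamming_le_card_support {N : ℕ} (hN : 0 < N) (hf : (X ^ N - 1 : F[X]) ≠ 0) {g P : F[X]}
    (hgP : g ∣ P) (hP : ¬ (X ^ N - 1 : F[X]) ∣ P) :
    dHamming hf (Ideal.span {AdjoinRoot.mk _ g}) ≤ P.support.card := by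
  refine le_trans (Nat.sInf_le ?_) (hammingWeight_mk_le_card_support hN hf P)
  exact ⟨_, Ideal.mem_span_singleton.mpr (map_dvd _ hgP),
    fun h => hP (AdjoinRoot.mk_eq_zero.mp h), rfl⟩

theorem le_dHamming_of_forall_card_support {f : F[X]} (hf : f ≠ 0) (hdeg : 0 < f.natDegree)
    {g : F[X]} (hgf : g ∣ f) (hfg : ¬ f ∣ g) {w : ℕ}
    (hw : ∀ Q : F[X], Q ≠ 0 → Q.natDegree < f.natDegree → g ∣ Q → w ≤ Q.support.card) :
    w ≤ dHamming hf (Ideal.span {AdjoinRoot.mk f g}) := by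
  refine le_csInf ⟨_, AdjoinRoot.mk f g, Ideal.mem_span_singleton_self _,
    fun h => hfg (AdjoinRoot.mk_eq_zero.mp h), rfl⟩ ?_
  rintro _ ⟨x, hx, hx0, rfl⟩
  obtain ⟨Q, hQ, rfl⟩ := exists_natDegree_lt_mk_eq hdeg x
  rw [hammingWeight_mk_of_natDegree_lt hf hQ]
  refine hw Q ?_ hQ ((mk_mem_span_mk_iff hgf Q).mp hx)
  rintro rfl
  exact hx0 (map_zero _)

theorem dHamming_bot {f : F[X]} (hf : f ≠ 0) : dHamming hf (⊥ : Ideal (AdjoinRoot f)) = 0 := by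
  rw [dHamming, Nat.sInf_eq_zero]
  right
  ext w
  simp only [Set.mem_ofPred_eq, Set.mem_empty_iff_false, iff_false, not_exists, not_and]
  intro x hx hx0
  exact absurd (Ideal.mem_bot.mp hx) hx0

/-- A nonzero `Q` of degree `< N` such that `X ^ N - 1` divides `Q * (X - z)` has no vanishing
coefficient below degree `N`. -/
theorem card_support_of_dvd_mul_X_sub_C {N : ℕ} {Q : F[X]} {z : F} (hQ0 : Q ≠ 0)
    (hQ : Q.natDegree < N) (hdvd : (X ^ N - 1 : F[X]) ∣ Q * (X - C z)) :
    N ≤ Q.support.card := by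
  have hN : 0 < N := by omega
  have hmonic : (X ^ N - 1 : F[X]).Monic := by
    simpa using monic_X_pow_sub_C (1 : F) hN.ne'
  have hdeg : (X ^ N - 1 : F[X]).natDegree = N := by
    simpa using natDegree_X_pow_sub_C (n := N) (r := (1 : F))
  obtain ⟨R, hR⟩ := hdvd
  have hR0 : R ≠ 0 := by
    rintro rfl
    simp [hQ0, X_sub_C_ne_zero] at hR
  have hRdeg : R.natDegree = 0 := by
    have h := congrArg natDegree hR
    rw [natDegree_mul hQ0 (X_sub_C_ne_zero z), natDegree_X_sub_C,
      natDegree_mul hmonic.ne_zero hR0, hdeg] at h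
    omega
  obtain ⟨c, rfl⟩ := natDegree_eq_zero.mp hRdeg
  have hc : c ≠ 0 := fun h => hR0 (by simp [h])
  have hcoeff : ∀ i < N, Q.coeff i ≠ 0 := by
    intro i
    induction i with
    | zero =>
      intro _ h
      have h0 := congrArg (coeff · 0) hR
      simp [h, coeff_X_pow, hN.ne] at h0
      exact hc h0
    | succ i ih =>
      intro hi h
      have h1 := congrArg (coeff · (i + 1)) hR
      simp only [coeff_mul_X_sub_C, coeff_mul_C, coeff_sub, coeff_X_pow, coeff_one, h] at h1
      simp [hi.ne] at h1
      exact ih (by omega) h1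
  calc N = (Finset.range N).card := (Finset.card_range N).symm
    _ ≤ Q.support.card := Finset.card_le_card fun i hi =>
      mem_support_iff.mpr (hcoeff i (Finset.mem_range.mp hi))

theorem card_support_expand_le (n : ℕ) (hn : 0 < n) (P : F[X]) :
    (expand F n P).support.card ≤ P.natDegree + 1 := by
  refine le_trans ?_ ((Finset.card_image_le (s := Finset.range (P.natDegree + 1))
    (f := (· * n))).trans_eq (Finset.card_range _))
  refine Finset.card_le_card fun k hk => ?_
  rw [mem_support_iff, coeff_expand hn] at hk
  split_ifs at hk with h
  · exact Finset.mem_image.mpr ⟨k / n, Finset.mem_range_succ_iff.mpr (le_natDegree_of_ne_zero hk),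
      Nat.div_mul_cancel h⟩
  · exact absurd rfl hk

theorem card_support_X_pow_sub_one_pow_le (n : ℕ) (hn : 0 < n) (e : ℕ) :
    ((X ^ n - 1 : F[X]) ^ e).support.card ≤ e + 1 := by
  have h : (X ^ n - 1 : F[X]) ^ e = expand F n ((X - C 1) ^ e) := by simp
  rw [h]
  refine (card_support_expand_le n hn _).trans ?_
  simp [natDegree_pow, -map_one]

theorem card_support_pow_char_pow_le (p s : ℕ) [Fact p.Prime] [CharP F p] (P : F[X]) :
    (P ^ p ^ s).support.card ≤ P.natDegree + 1 := by
  rw [← map_iterateFrobenius_expand p P s]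
  exact (Finset.card_le_card (support_map_subset _ _)).trans
    (card_support_expand_le _ (pow_pos (Fact.out : p.Prime).pos s) P)

theorem le_of_X_sub_C_pow_dvd_prod {ι : Type*} [Fintype ι] {z : ι → F}
    (hz : Function.Injective z) {v : ι → ℕ} {h : ι} {u : ℕ}
    (hdvd : (X - C (z h)) ^ u ∣ ∏ i, (X - C (z i)) ^ v i) : u ≤ v h := by
  by_contra! hlt
  rw [← Finset.mul_prod_erase _ _ (Finset.mem_univ h)] at hdvd
  have h1 := (pow_dvd_pow (X - C (z h)) hlt).trans hdvd
  rw [pow_succ, mul_dvd_mul_iff_left (pow_ne_zero _ (X_sub_C_ne_zero _)), dvd_iff_isRoot,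
    IsRoot.def, eval_prod, Finset.prod_eq_zero_iff] at h1
  obtain ⟨i, hi, hi0⟩ := h1
  rw [eval_pow, eval_sub, eval_X, eval_C] at hi0
  exact Finset.ne_of_mem_erase hi (hz (sub_eq_zero.mp (eq_zero_of_pow_eq_zero hi0))).symm

theorem IsPrimitiveRoot.prod_fin_X_sub_C_pow {θ : F} {n : ℕ} (hn : 0 < n)
    (hθ : IsPrimitiveRoot θ n) : ∏ i : Fin n, (X - C (θ ^ (i : ℕ))) = X ^ n - 1 := by
  have hinj : Function.Injective fun i : Fin n => θ ^ (i : ℕ) := fun i i' h =>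
    Fin.ext (hθ.pow_inj i.2 i'.2 h)
  rw [X_pow_sub_one_eq_prod hn hθ]
  have himage : nthRootsFinset n (1 : F) = Finset.univ.image fun i : Fin n => θ ^ (i : ℕ) := by
    symm
    refine Finset.eq_of_subset_of_card_le ?_ ?_
    · intro x hx
      obtain ⟨i, -, rfl⟩ := Finset.mem_image.mp hx
      rw [Polynomial.mem_nthRootsFinset hn, ← pow_mul, mul_comm, pow_mul, hθ.pow_eq_one, one_pow]
    · rw [hθ.card_nthRootsFinset, Finset.card_image_of_injective _ hinj, Finset.card_univ,
        Fintype.card_fin]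
  rw [himage, Finset.prod_image hinj.injOn]

end QuotientCodes

/-- The combinatorial core: a non-increasing exponent sequence bounded by `t`, for which the weight
bounds of the test codewords leave room for the Singleton bound, is one of the three MDS types. -/
theorem exponents_of_test_bounds {n t J : ℕ} (hn : 2 ≤ n) (ht : 3 ≤ t) (j : Fin n → ℕ)
    (hj : ∀ h, j h ≤ t) (hanti : Antitone j) (hJ : J = ∑ h, j h)
    (hlast : j ⟨n - 1, by omega⟩ < t)
    (hconst : j ⟨0, by omega⟩ < t → J ≤ j ⟨0, by omega⟩)
    (hsingle : j ⟨1, by omega⟩ = 0 → J ≤ 1)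
    (hmixed : J + 1 ≤ ((Finset.univ.filter fun h => j ⟨n - 1, by omega⟩ < j h).card + 1) *
      (j ⟨n - 1, by omega⟩ + 1)) :
    j ⟨0, by omega⟩ = 0 ∨ (j ⟨0, by omega⟩ = 1 ∧ j ⟨1, by omega⟩ = 0) ∨
      ((∀ h : Fin n, (h : ℕ) < n - 1 → j h = t) ∧ j ⟨n - 1, by omega⟩ = t - 1) := by
  set z : Fin n := ⟨0, by omega⟩ with hz
  set o : Fin n := ⟨1, by omega⟩ with ho
  set l : Fin n := ⟨n - 1, by omega⟩ with hl
  rcases (hj z).lt_or_eq with h0 | h0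
  · have hpair : j z + j o ≤ J := by
      have hne : z ≠ o := by simp [hz, ho]
      rw [hJ, ← Finset.sum_pair hne]
      exact Finset.sum_le_sum_of_subset (Finset.subset_univ _)
    have := hconst h0
    have := hsingle (by omega)
    omega
  · right; right
    set S := Finset.univ.filter fun h => j l < j h with hS
    have hlow : ∑ h : Fin n, (j l + (if j l < j h then 1 else 0) +
        (if h = z then t - j l - 1 else 0)) ≤ J := by
      rw [hJ]
      refine Finset.sum_le_sum fun h _ => ?_
      have hle : j l ≤ j h := hanti (Fin.le_def.mpr (by simp only [hl]; omega))
      split_ifs with h1 h2 h2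
      · subst h2; omega
      · omega
      · subst h2; omega
      · omega
    rw [Finset.sum_add_distrib, Finset.sum_add_distrib, Finset.sum_const, Finset.card_univ,
      Fintype.card_fin, Finset.sum_boole, Finset.sum_ite_eq' Finset.univ z, if_pos
      (Finset.mem_univ z), smul_eq_mul, ← hS, Nat.cast_id] at hlow
    have hSsub : S ⊆ Finset.univ.erase l := by
      intro h hh
      rw [hS, Finset.mem_filter] at hh
      refine Finset.mem_erase.mpr ⟨?_, Finset.mem_univ _⟩
      rintro rfl
      exact lt_irrefl _ hh.2
    have hcard : (Finset.univ.erase l).card = n - 1 := by simp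
    have hk : S.card ≤ n - 1 := hcard ▸ Finset.card_le_card hSsub
    obtain ⟨d, hd⟩ := Nat.exists_eq_add_of_le hk
    have hnd : n = S.card + d + 1 := by omega
    have hzero : d * j l + (t - j l - 1) = 0 := by
      have : n * j l = S.card * j l + d * j l + j l := by
        conv_lhs => rw [hnd]
        ring
      nlinarith
    have he : j l = t - 1 := by omega
    have hd0 : d = 0 := by
      rcases mul_eq_zero.mp (show d * j l = 0 by omega) with h | h
      · exact h
      · omega
    have hSeq : S = Finset.univ.erase l :=
      Finset.eq_of_subset_of_card_le hSsub (by omega)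
    refine ⟨fun h hh => ?_, he⟩
    have hmem : h ∈ S := by
      rw [hSeq, Finset.mem_erase]
      refine ⟨?_, Finset.mem_univ _⟩
      rintro rfl
      simp [hl] at hh
    rw [hS, Finset.mem_filter] at hmem
    have := hj h
    omega

section RepeatedRootCyclicCodes

variable {F : Type*} [Field F]

theorem prod_X_sub_C_pow_dvd {ι : Type*} [Fintype ι] (z : ι → F) {u v : ι → ℕ} (huv : u ≤ v) :
    ∏ i, (X - C (z i)) ^ u i ∣ ∏ i, (X - C (z i)) ^ v i :=
  Finset.prod_dvd_prod_of_dvd _ _ fun i _ => pow_dvd_pow _ (huv i)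

theorem natDegree_prod_X_sub_C_pow {ι : Type*} [Fintype ι] (z : ι → F) (v : ι → ℕ) :
    (∏ i, (X - C (z i)) ^ v i).natDegree = ∑ i, v i := by
  rw [natDegree_prod_of_monic _ _ fun i _ => (monic_X_sub_C _).pow _]
  simp [natDegree_pow]

/-- Minimum distance of the code generated by `∏ (X - z i) ^ v i` in terms of test exponents. -/
theorem dHamming_le_of_exponents {ι : Type*} [Fintype ι] {z : ι → F} (hz : Function.Injective z)
    {N t : ℕ} (hN : 0 < N) (hf : (X ^ N - 1 : F[X]) ≠ 0)
    (hfac : (X ^ N - 1 : F[X]) = ∏ i, (X - C (z i)) ^ t) {u v : ι → ℕ} (huv : u ≤ v)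
    {h : ι} (hv : v h < t) {w : ℕ} (hw : (∏ i, (X - C (z i)) ^ v i).support.card ≤ w) :
    dHamming hf (Ideal.span {AdjoinRoot.mk _ (∏ i, (X - C (z i)) ^ u i)}) ≤ w := by
  refine (dHamming_le_card_support hN hf (prod_X_sub_C_pow_dvd z huv) fun hdvd => ?_).trans hw
  rw [hfac] at hdvd
  exact hv.not_ge (le_of_X_sub_C_pow_dvd_prod hz
    ((Finset.dvd_prod_of_mem (fun i => (X - C (z i)) ^ t) (Finset.mem_univ h)).trans hdvd))

end RepeatedRootCyclicCodes

/-- with `q = p^m = 2^a·b+1`, `a ≥ r ≥ 1`, `θ ∈ F_q` a primitive `2^r`-th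
root of unity, `(i_h) = (σ h)` a permutation of `0,…,2^r−1` and
`p^s ≥ j_0 ≥ … ≥ j_{2^r−1} ≥ 0`, the cyclic code
`C = ⟨∏_h (x − θ^{i_h})^{j_h}⟩ ⊆ F_q[x]/(x^{2^r p^s} − 1)` is MDS iff exactly one of:
(1) `j_0 = 0` (then `d_H(C) = 1`); (2) `j_0 = 1, j_1 = 0` (then `d_H(C) = 2`);
(3) `j_0 = … = j_{2^r−2} = p^s, j_{2^r−1} = p^s−1` (then `d_H(C) = 2^r p^s`). -/
theorem stmt15 (p m a b r s : ℕ) (hp : p.Prime) (hpodd : Odd p) (hm : 0 < m) (hs : 0 < s)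
    (hb : Odd b) (hr : 1 ≤ r) (hra : r ≤ a) (hq : p ^ m = 2 ^ a * b + 1)
    (F : Type*) [Field F] [Fintype F] (hF : Fintype.card F = p ^ m)
    (θ : F) (hθ : IsPrimitiveRoot θ (2 ^ r))
    (σ : Equiv.Perm (Fin (2 ^ r)))
    (j : Fin (2 ^ r) → ℕ) (hj : ∀ h, j h ≤ p ^ s)
    (hanti : ∀ h h' : Fin (2 ^ r), h ≤ h' → j h' ≤ j h)
    (N : ℕ) (hN : N = 2 ^ r * p ^ s)
    (hf : (X ^ N - 1 : Polynomial F) ≠ 0)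
    (C : Ideal (AdjoinRoot (X ^ N - 1 : Polynomial F)))
    (hC : C = Ideal.span {AdjoinRoot.mk (X ^ N - 1 : Polynomial F)
      (∏ h : Fin (2 ^ r), (X - Polynomial.C (θ ^ (σ h : ℕ))) ^ j h)}) :
    (dHamming hf C = N - Module.finrank F (Submodule.restrictScalars F C) + 1 ↔
      j ⟨0, Nat.two_pow_pos r⟩ = 0 ∨
      (j ⟨0, Nat.two_pow_pos r⟩ = 1 ∧ j ⟨1, Nat.one_lt_two_pow_iff.mpr (by omega)⟩ = 0) ∨
      ((∀ h : Fin (2 ^ r), (h : ℕ) < 2 ^ r - 1 → j h = p ^ s) ∧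
        j (lastIdx r) = p ^ s - 1)) ∧
    (j ⟨0, Nat.two_pow_pos r⟩ = 0 → dHamming hf C = 1) ∧
    ((j ⟨0, Nat.two_pow_pos r⟩ = 1 ∧ j ⟨1, Nat.one_lt_two_pow_iff.mpr (by omega)⟩ = 0) →
      dHamming hf C = 2) ∧
    (((∀ h : Fin (2 ^ r), (h : ℕ) < 2 ^ r - 1 → j h = p ^ s) ∧
        j (lastIdx r) = p ^ s - 1) →
      dHamming hf C = 2 ^ r * p ^ s) := by
  have : Fact p.Prime := ⟨hp⟩
  have : CharP F p := charP_of_card_eq_prime_pow hF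
  have hn : 2 ≤ 2 ^ r := Nat.one_lt_two_pow_iff.mpr (by omega)
  have hn0 : 0 < 2 ^ r := Nat.two_pow_pos r
  have ht : 3 ≤ p ^ s := by
    have h2 := hp.two_le
    have h3 : p ≠ 2 := by rintro rfl; exact absurd hpodd (by decide)
    exact (show 3 ≤ p by omega).trans (Nat.le_self_pow hs.ne' p)
  have hN0 : 0 < N := hN ▸ Nat.mul_pos hn0 (by omega)
  have hdeg : (X ^ N - 1 : F[X]).natDegree = N := by
    simpa using natDegree_X_pow_sub_C (n := N) (r := (1 : F))
  set z : Fin (2 ^ r) → F := fun h => θ ^ (σ h : ℕ)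
  have hz : Function.Injective z := fun h h' e =>
    σ.injective (Fin.ext (hθ.pow_inj (σ h).2 (σ h').2 e))
  have hprod : ∏ h, (X - Polynomial.C (z h)) = X ^ 2 ^ r - 1 :=
    (Equiv.prod_comp σ fun i => X - Polynomial.C (θ ^ (i : ℕ))).trans
      (hθ.prod_fin_X_sub_C_pow hn0)
  have hfac : (X ^ N - 1 : F[X]) = ∏ h, (X - Polynomial.C (z h)) ^ p ^ s := by
    rw [Finset.prod_pow, hprod, sub_pow_char_pow, one_pow, ← pow_mul, hN]
  have hgf : ∏ h, (X - Polynomial.C (z h)) ^ j h ∣ (X ^ N - 1 : F[X]) :=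
    hfac ▸ prod_X_sub_C_pow_dvd z hj
  have hgdeg := natDegree_prod_X_sub_C_pow z j
  set J := ∑ h, j h with hJ
  have hfin : N - Module.finrank F (Submodule.restrictScalars F C) = J := by
    have h := finrank_span_mk_add_natDegree hf hgf
    rw [← hC, hgdeg, hdeg] at h
    omega
  have hnotdvd : j (lastIdx r) < p ^ s →
      ¬ (X ^ N - 1 : F[X]) ∣ ∏ h, (X - Polynomial.C (z h)) ^ j h := by
    intro h hdvd
    rw [hfac] at hdvd
    exact h.not_ge (le_of_X_sub_C_pow_dvd_prod hz ((Finset.dvd_prod_of_mem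
      (fun i => (X - Polynomial.C (z i)) ^ p ^ s) (Finset.mem_univ (lastIdx r))).trans hdvd))
  have hle_last : ∀ h, j (lastIdx r) ≤ j h := fun h =>
    hanti h _ (Fin.le_def.mpr (by simp only [lastIdx]; omega))
  have hle_zero : ∀ h, j h ≤ j ⟨0, hn0⟩ := fun h => hanti _ h (Fin.le_def.mpr (Nat.zero_le _))
  have hconst : j ⟨0, hn0⟩ < p ^ s → dHamming hf C ≤ j ⟨0, hn0⟩ + 1 := by
    intro h
    rw [hC]
    refine dHamming_le_of_exponents hz hN0 hf hfac (v := fun _ => j ⟨0, hn0⟩) hle_zero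
      (h := ⟨0, hn0⟩) h ?_
    rw [Finset.prod_pow, hprod]
    exact card_support_X_pow_sub_one_pow_le _ hn0 _
  have hzero_of_one : j ⟨1, hn⟩ = 0 → ∀ h, h ≠ ⟨0, hn0⟩ → j h = 0 := by
    intro h1 h hh
    have hpos : (h : ℕ) ≠ 0 := fun e => hh (Fin.ext e)
    have := hanti ⟨1, hn⟩ h (Fin.le_def.mpr (Nat.one_le_iff_ne_zero.mpr hpos))
    omega
  have hsingle : j ⟨1, hn⟩ = 0 → dHamming hf C ≤ 2 := by
    intro h1
    rw [hC]
    refine dHamming_le_of_exponents hz hN0 hf hfac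
      (v := fun h => if h = ⟨0, hn0⟩ then p ^ s else 0) ?_ (h := ⟨1, hn⟩) ?_ ?_
    · intro h
      dsimp only
      split_ifs with hh
      · exact hj h
      · exact (hzero_of_one h1 h hh).le
    · simp only [Fin.mk.injEq, one_ne_zero, if_false]
      omega
    · have hv : ∏ h, (X - Polynomial.C (z h)) ^ (if h = ⟨0, hn0⟩ then p ^ s else 0) =
          (X - Polynomial.C (z ⟨0, hn0⟩)) ^ p ^ s := by
        rw [Finset.prod_eq_single_of_mem _ (Finset.mem_univ ⟨0, hn0⟩)
          fun i _ hi => by rw [if_neg hi, pow_zero], if_pos rfl]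
      rw [hv]
      refine (card_support_pow_char_pow_le p s _).trans ?_
      rw [natDegree_X_sub_C]
  have hmixed : j (lastIdx r) < p ^ s → dHamming hf C ≤
      ((Finset.univ.filter fun h => j (lastIdx r) < j h).card + 1) * (j (lastIdx r) + 1) := by
    intro hl
    rw [hC]
    refine dHamming_le_of_exponents hz hN0 hf hfac
      (v := fun h => j (lastIdx r) + if j (lastIdx r) < j h then p ^ s else 0) ?_
      (h := lastIdx r) (by simpa using hl) ?_
    · intro h
      dsimp only
      split_ifs with hh
      · exact (hj h).trans (Nat.le_add_left _ _)
      · exact not_lt.mp hh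
    · simp only [pow_add, Finset.prod_mul_distrib]
      rw [Finset.prod_pow, hprod, mul_comm]
      simp only [pow_ite, pow_zero]
      rw [← Finset.prod_filter, Finset.prod_pow]
      refine (card_support_mul_le).trans (Nat.mul_le_mul ?_ ?_)
      · refine (card_support_pow_char_pow_le p s _).trans (le_of_eq ?_)
        rw [natDegree_prod_of_monic _ _ fun i _ => monic_X_sub_C _]
        simp
      · exact card_support_X_pow_sub_one_pow_le _ hn0 _
  have htrivial : j ⟨0, hn0⟩ = 0 → dHamming hf C = 1 := by
    intro h0
    have hlast := hle_last ⟨0, hn0⟩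
    refine le_antisymm ((hconst (by omega)).trans_eq (by rw [h0])) ?_
    rw [hC]
    refine le_dHamming_of_forall_card_support hf (by omega) hgf (hnotdvd (by omega)) ?_
    intro Q hQ0 _ _
    exact Finset.card_pos.mpr (support_nonempty.mpr hQ0)
  have hparity : j ⟨0, hn0⟩ = 1 ∧ j ⟨1, hn⟩ = 0 → dHamming hf C = 2 := by
    rintro ⟨h0, h1⟩
    have hlast := hle_last ⟨0, hn0⟩
    refine le_antisymm (hsingle h1) ?_
    rw [hC]
    refine le_dHamming_of_forall_card_support hf (by omega) hgf (hnotdvd (by omega)) ?_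
    intro Q hQ0 _ hgQ
    by_contra! hlt
    obtain ⟨k, c, rfl⟩ := card_support_le_one_iff_monomial.mp (Nat.lt_succ_iff.mp hlt)
    have hroot := ((Finset.dvd_prod_of_mem (fun h => (X - Polynomial.C (z h)) ^ j h)
      (Finset.mem_univ ⟨0, hn0⟩)).trans hgQ)
    rw [h0, pow_one, dvd_iff_isRoot, IsRoot.def, eval_monomial] at hroot
    rcases mul_eq_zero.mp hroot with h | h
    · exact hQ0 (by rw [h, monomial_zero_right])
    · exact pow_ne_zero _ (pow_ne_zero _ (hθ.ne_zero hn0.ne')) h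
  have hrep_mul : ((∀ h : Fin (2 ^ r), (h : ℕ) < 2 ^ r - 1 → j h = p ^ s) ∧
      j (lastIdx r) = p ^ s - 1) → (∏ h, (X - Polynomial.C (z h)) ^ j h) *
        (X - Polynomial.C (z (lastIdx r))) = X ^ N - 1 := by
    rintro ⟨hlt, hl⟩
    have hX : X - Polynomial.C (z (lastIdx r)) =
        ∏ h, (X - Polynomial.C (z h)) ^ (if h = lastIdx r then 1 else 0) := by
      simp [pow_ite]
    rw [hX, ← Finset.prod_mul_distrib, hfac]
    refine Finset.prod_congr rfl fun h _ => ?_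
    rw [← pow_add]
    congr 1
    split_ifs with hh
    · rw [hh, hl]
      omega
    · refine hlt h ?_
      have : (h : ℕ) ≠ 2 ^ r - 1 := fun e => hh (Fin.ext e)
      omega
  have hrep_sum : ((∀ h : Fin (2 ^ r), (h : ℕ) < 2 ^ r - 1 → j h = p ^ s) ∧
      j (lastIdx r) = p ^ s - 1) → J + 1 = N := by
    intro h
    have hmul := congrArg natDegree (hrep_mul h)
    rwa [natDegree_mul (ne_zero_of_dvd_ne_zero hf hgf) (X_sub_C_ne_zero _), hgdeg,
      natDegree_X_sub_C, hdeg] at hmul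
  have hrep : ((∀ h : Fin (2 ^ r), (h : ℕ) < 2 ^ r - 1 → j h = p ^ s) ∧
      j (lastIdx r) = p ^ s - 1) → dHamming hf C = N := by
    intro h
    have hnd := hnotdvd (by omega)
    rw [hC]
    refine le_antisymm ?_ ?_
    · refine (dHamming_le_card_support hN0 hf dvd_rfl hnd).trans ?_
      exact (card_supp_le_succ_natDegree _).trans_eq (by rw [hgdeg, hrep_sum h])
    · refine le_dHamming_of_forall_card_support hf (by omega) hgf hnd ?_
      intro Q hQ0 hQ hgQ
      refine card_support_of_dvd_mul_X_sub_C hQ0 (hdeg ▸ hQ) (z := z (lastIdx r)) ?_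
      rw [← hrep_mul h]
      exact mul_dvd_mul_right hgQ _
  refine ⟨⟨fun hd => ?_, ?_⟩, htrivial, hparity, fun h => (hrep h).trans hN⟩
  · rw [hfin] at hd
    have hl : j (lastIdx r) < p ^ s := by
      refine (hj _).lt_of_ne fun hl => ?_
      have hall : ∀ h, j h = p ^ s := fun h => le_antisymm (hj h) (hl ▸ hle_last h)
      have hbot : C = ⊥ := by
        rw [hC, Ideal.span_singleton_eq_bot, AdjoinRoot.mk_eq_zero, hfac]
        simp only [hall]
        exact dvd_refl _
      rw [hbot, dHamming_bot] at hd
      omega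
    refine exponents_of_test_bounds hn ht j hj (fun h h' => hanti h h') hJ hl (fun h => ?_)
      (fun h => ?_) ?_
    · have := hconst h
      omega
    · have := hsingle h
      omega
    · exact hd ▸ hmixed hl
  · rw [hfin]
    rintro (h | h | h)
    · have hsum : J = 0 := Finset.sum_eq_zero fun i _ => Nat.le_zero.mp (h ▸ hle_zero i)
      rw [htrivial h, hsum]
    · have hsum : J = 1 := by
        rw [hJ, Finset.sum_eq_single_of_mem _ (Finset.mem_univ ⟨0, hn0⟩)
          fun i _ hi => hzero_of_one h.2 i hi, h.1]
      rw [hparity h, hsum]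
    · rw [hrep h, hrep_sum h]
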